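/- Let σ > 0, let F : ℝ → ℝ be continuous, and let N, M : ℝ → ℝ be bounded, twice continuously differentiable functions satisfying N''(x) = σ²(N(x) − F(M(x))) and M''(x) = σ²(M(x) − F(N(x))) for all x ∈ ℝ. Then N = Q[M] and M = Q[N], where Q[N](x) = ∫_ℝ (σ/2)e^{−σ|x−y|} F(N(y)) dy. -/

import Mathlib

open MeasureTheory

open Filter Topology Set in
theorem half_aux (σ : ℝ) (hσ : 0 < σ) (N g : ℝ → ℝ) (hg : Continuous g)
    (hNb : ∃ C : ℝ, ∀ x, |N x| ≤ C) (hgb : ∃ C : ℝ, ∀ x, |g x| ≤ C)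
    (hN2 : ContDiff ℝ 2 N)
    (hNeq : ∀ x : ℝ, deriv (deriv N) x = σ ^ 2 * (N x - g x)) (x : ℝ) :
    N x = ∫ y : ℝ, σ / 2 * Real.exp (-σ * |x - y|) * g y := by
  obtain ⟨A, hA⟩ := hNb
  obtain ⟨B, hB⟩ := hgb
  have hd1 : Differentiable ℝ N := hN2.differentiable (by norm_num)
  have hc1 : ContDiff ℝ 1 (deriv N) := by
    have h : ContDiff ℝ (1 + 1) N := by simpa [one_add_one_eq_two] using hN2
    exact (contDiff_succ_iff_deriv.1 h).2.2
  have hd2 : Differentiable ℝ (deriv N) := hc1.differentiable (by norm_num)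
  have hN' : ∀ y, HasDerivAt N (deriv N y) y := fun y => (hd1 y).hasDerivAt
  have hN'' : ∀ y, HasDerivAt (deriv N) (σ ^ 2 * (N y - g y)) y := fun y => by
    rw [← hNeq]; exact (hd2 y).hasDerivAt
  have hDb : ∀ y, |deriv N y| ≤ 2 * A + σ ^ 2 * (A + B) := by
    intro y
    obtain ⟨c, hc, hc'⟩ := exists_hasDerivAt_eq_slope N (deriv N) (show y < y + 1 by linarith)
      hd1.continuous.continuousOn (fun z _ => hN' z)
    obtain ⟨d, hd, hd'⟩ := exists_hasDerivAt_eq_slope (deriv N) _ hc.1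
      hd2.continuous.continuousOn (fun z _ => hN'' z)
    have e1 : deriv N c = N (y + 1) - N y := by rw [hc']; ring_nf
    have hcy : 0 < c - y := by linarith [hc.1]
    have e2 : deriv N c - deriv N y = σ ^ 2 * (N d - g d) * (c - y) := by
      rw [hd']; field_simp
    have b1 : |N (y + 1) - N y| ≤ 2 * A := by
      have := abs_sub (N (y + 1)) (N y)
      linarith [hA (y + 1), hA y]
    have b2 : |σ ^ 2 * (N d - g d) * (c - y)| ≤ σ ^ 2 * (A + B) := by
      rw [abs_mul, abs_mul, abs_of_pos hcy, abs_of_pos (by positivity : 0 < σ ^ 2)]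
      have h0 := abs_sub (N d) (g d)
      have h1 : |N d - g d| ≤ A + B := by linarith [hA d, hB d]
      have h2 : c - y ≤ 1 := by linarith [hc.2]
      have h3 : 0 ≤ σ ^ 2 * |N d - g d| := by positivity
      calc _ ≤ σ ^ 2 * |N d - g d| * 1 := by gcongr
        _ ≤ _ := by rw [mul_one]; gcongr
    have e3 : deriv N y = (N (y + 1) - N y) - σ ^ 2 * (N d - g d) * (c - y) := by linarith
    rw [e3]
    have := abs_sub (N (y + 1) - N y) (σ ^ 2 * (N d - g d) * (c - y))
    linarith
  -- right half
  have iR : IntegrableOn (fun y => Real.exp (-σ * (y - x)) * g y) (Ioi x) := by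
    have h : IntegrableOn (fun y => Real.exp (-σ * (y - x))) (Ioi x) := by
      have := (integrableOn_exp_mul_Ioi (neg_lt_zero.2 hσ) x).mul_const (Real.exp (σ * x))
      refine this.congr (ae_of_all _ fun y => ?_)
      simp only [← Real.exp_add]; ring_nf
    exact Integrable.mul_bdd (c := B) h hg.aestronglyMeasurable (ae_of_all _ fun y => by
      simpa using hB y)
  have iL : IntegrableOn (fun y => Real.exp (σ * (y - x)) * g y) (Iic x) := by
    have h : IntegrableOn (fun y => Real.exp (σ * (y - x))) (Iic x) := by
      have := (integrableOn_exp_mul_Iic hσ x).mul_const (Real.exp (-σ * x))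
      refine this.congr (ae_of_all _ fun y => ?_)
      simp only [← Real.exp_add]; ring_nf
    exact Integrable.mul_bdd (c := B) h hg.aestronglyMeasurable (ae_of_all _ fun y => by
      simpa using hB y)
  have R := integral_Ioi_of_hasDerivAt_of_tendsto' (a := x) (m := 0)
    (f := fun y => Real.exp (-σ * (y - x)) * (deriv N y + σ * N y))
    (f' := fun y => -σ ^ 2 * (Real.exp (-σ * (y - x)) * g y)) (by
      intro y _
      have he : HasDerivAt (fun y => Real.exp (-σ * (y - x))) (Real.exp (-σ * (y - x)) * (-σ * 1)) y :=
        (((hasDerivAt_id y).sub_const x).const_mul (-σ)).exp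
      refine HasDerivAt.congr_deriv (he.mul ((hN'' y).add ((hN' y).const_mul σ))) ?_
      ring) (iR.const_mul _) (by
      refine Tendsto.zero_mul_isBoundedUnder_le ?_ ?_
      · refine Real.tendsto_exp_atBot.comp ?_
        exact (tendsto_atTop_add_const_right _ (-x) tendsto_id).const_mul_atTop_of_neg (neg_lt_zero.2 hσ)
      · refine isBoundedUnder_of ⟨2 * A + σ ^ 2 * (A + B) + σ * A, fun y => ?_⟩
        simp only [Function.comp, Real.norm_eq_abs]
        refine (abs_add_le _ _).trans ?_
        rw [abs_mul, abs_of_pos hσ]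
        gcongr
        · exact hDb y
        · exact hA y)
  have L := integral_Iic_of_hasDerivAt_of_tendsto' (a := x) (m := 0)
    (f := fun y => Real.exp (σ * (y - x)) * (deriv N y - σ * N y))
    (f' := fun y => -σ ^ 2 * (Real.exp (σ * (y - x)) * g y)) (by
      intro y _
      have he : HasDerivAt (fun y => Real.exp (σ * (y - x))) (Real.exp (σ * (y - x)) * (σ * 1)) y :=
        (((hasDerivAt_id y).sub_const x).const_mul σ).exp
      refine HasDerivAt.congr_deriv (he.mul ((hN'' y).sub ((hN' y).const_mul σ))) ?_
      ring) (iL.const_mul _) (by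
      refine Tendsto.zero_mul_isBoundedUnder_le ?_ ?_
      · refine Real.tendsto_exp_atBot.comp ?_
        exact (tendsto_atBot_add_const_right _ (-x) tendsto_id).const_mul_atBot hσ
      · refine isBoundedUnder_of ⟨2 * A + σ ^ 2 * (A + B) + σ * A, fun y => ?_⟩
        simp only [Function.comp, Real.norm_eq_abs]
        refine (abs_sub _ _).trans ?_
        rw [abs_mul, abs_of_pos hσ]
        gcongr
        · exact hDb y
        · exact hA y)
  rw [integral_const_mul] at R L
  simp only [sub_self, mul_zero, Real.exp_zero, one_mul, zero_sub, sub_zero] at R L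
  have cR : EqOn (fun y => σ / 2 * (Real.exp (-σ * (y - x)) * g y))
      (fun y => σ / 2 * Real.exp (-σ * |x - y|) * g y) (Ioi x) := by
    intro y hy
    have : |x - y| = y - x := by rw [abs_sub_comm, abs_of_pos (sub_pos.2 hy)]
    simp only [this]; ring
  have cL : EqOn (fun y => σ / 2 * (Real.exp (σ * (y - x)) * g y))
      (fun y => σ / 2 * Real.exp (-σ * |x - y|) * g y) (Iic x) := by
    intro y hy
    have h1 : |x - y| = x - y := abs_of_nonneg (sub_nonneg.2 hy)
    have h2 : -σ * (x - y) = σ * (y - x) := by ring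
    simp only [h1, h2]; ring
  have jR := (integrableOn_congr_fun cR measurableSet_Ioi).1 (iR.const_mul _)
  have jL := (integrableOn_congr_fun cL measurableSet_Iic).1 (iL.const_mul _)
  rw [← setIntegral_univ, ← Set.Iic_union_Ioi (a := x),
    setIntegral_union (Iic_disjoint_Ioi le_rfl) measurableSet_Ioi jL jR,
    ← setIntegral_congr_fun measurableSet_Ioi cR, ← setIntegral_congr_fun measurableSet_Iic cL,
    integral_const_mul, integral_const_mul]
  apply mul_left_cancel₀ (pow_ne_zero 2 hσ.ne')
  linear_combination (-σ / 2) * (-L) + (σ / 2) * R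

theorem bdd_comp_aux (F N : ℝ → ℝ) (hF : Continuous F) (hNb : ∃ C : ℝ, ∀ x, |N x| ≤ C) :
    ∃ C : ℝ, ∀ x, |F (N x)| ≤ C := by
  obtain ⟨A, hA⟩ := hNb
  obtain ⟨C, hC⟩ := (isCompact_Icc (a := -A) (b := A)).exists_bound_of_continuousOn hF.continuousOn
  exact ⟨C, fun x => hC _ (abs_le.1 (hA x))⟩


/-- Converse direction: bounded twice continuously differentiable solutions of the
second-order ODE system are fixed points of the integrodifference operator pair. -/
theorem stmt2 (σ : ℝ) (hσ : 0 < σ) (F : ℝ → ℝ) (hF : Continuous F)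
    (N M : ℝ → ℝ)
    (hNb : ∃ C : ℝ, ∀ x, |N x| ≤ C) (hMb : ∃ C : ℝ, ∀ x, |M x| ≤ C)
    (hN2 : ContDiff ℝ 2 N) (hM2 : ContDiff ℝ 2 M)
    (hNeq : ∀ x : ℝ, deriv (deriv N) x = σ ^ 2 * (N x - F (M x)))
    (hMeq : ∀ x : ℝ, deriv (deriv M) x = σ ^ 2 * (M x - F (N x))) :
    (∀ x : ℝ, N x = ∫ y : ℝ, σ / 2 * Real.exp (-σ * |x - y|) * F (M y)) ∧
    (∀ x : ℝ, M x = ∫ y : ℝ, σ / 2 * Real.exp (-σ * |x - y|) * F (N y)) := by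
  
  exact ⟨half_aux σ hσ N _ (hF.comp hM2.continuous) hNb (bdd_comp_aux F M hF hMb) hN2 hNeq,
    half_aux σ hσ M _ (hF.comp hN2.continuous) hMb (bdd_comp_aux F N hF hNb) hM2 hMeq⟩
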